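/- For every reduced word w for the long word w0 in S_5, the number of 4-element subsets A of {1,2,3,4,5} for which the induced word of w on A belongs to the reentrant set X is 0, 2, or 4. Moreover, exactly 40 reduced words have this count equal to 4, exactly 400 have it equal to 2, and exactly 328 have it equal to 0. -/

import Mathlib

/-- The adjacent transposition `s_a`, swapping `a` and `a+1`, as a permutation of `ℕ`. -/
def adjTransposition (a : ℕ) : Equiv.Perm ℕ := Equiv.swap a (a + 1)

/-- The long word `w₀ = [n, n-1, …, 2, 1]` in `S_n`: the permutation of `ℕ` sending
`i` to `n + 1 - i` for `i ∈ {1, …, n}` and fixing all other natural numbers. -/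
def longWord (n : ℕ) : Equiv.Perm ℕ :=
  Function.Involutive.toPerm (fun i => if 1 ≤ i ∧ i ≤ n then n + 1 - i else i)
    (by intro i; dsimp only; split_ifs <;> omega)

/-- `w` is a reduced word for the long word in `S_n`: a sequence of letters in
`{1, …, n-1}` of length `C(n,2)` whose associated product of adjacent
transpositions `s_{a_1} s_{a_2} ⋯ s_{a_m}` equals `w₀`. -/
def IsReducedWord (n : ℕ) (w : List ℕ) : Prop :=
  w.length = n.choose 2 ∧ (∀ a ∈ w, 1 ≤ a ∧ a ≤ n - 1) ∧
    (w.map adjTransposition).prod = longWord n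

/-- Auxiliary recursion computing the induced word on a subset `A` of wires:
`π` is the current permutation `π_{k-1}` (with `π j` the wire in position `j`);
at a step with letter `a`, the wires `π a` and `π (a+1)` cross, and if both lie
in `A` we record the position of `a` among the positions currently occupied by
the wires of `A`. -/
def inducedAux (A : Finset ℕ) : List ℕ → Equiv.Perm ℕ → List ℕ
  | [], _ => []
  | a :: rest, π =>
      (if π a ∈ A ∧ π (a + 1) ∈ A
        then [((Finset.Icc 1 a).filter (fun p => π p ∈ A)).card]
        else []) ++ inducedAux A rest (π * adjTransposition a)

/-- The induced word of the word `w` on the subset `A` of wires. -/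
def inducedWord (w : List ℕ) (A : Finset ℕ) : List ℕ := inducedAux A w 1

/-- The reentrant set `X` of four reduced words for the long word in `S_4`. -/
def reentrantSet : Finset (List ℕ) :=
  {[1,2,3,2,1,2], [3,2,1,2,3,2], [2,1,2,3,2,1], [2,3,2,1,2,3]}

/-- The trace of `w` on all wires but the one in position `p`: only the position of the
missing wire has to be tracked. -/
def deleteWire : ℕ → List ℕ → List ℕ
  | _, [] => []
  | p, a :: w =>
      if p = a then deleteWire (a + 1) w
      else if p = a + 1 then deleteWire a w
      else if p < a then (a - 1) :: deleteWire p w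
      else a :: deleteWire p w

theorem adjTransposition_mem_Icc_iff {n a : ℕ} (ha : 1 ≤ a ∧ a ≤ n - 1) (j : ℕ) :
    adjTransposition a j ∈ Finset.Icc 1 n ↔ j ∈ Finset.Icc 1 n := by
  simp only [adjTransposition, Equiv.swap_apply_def, Finset.mem_Icc]
  split_ifs <;> omega

theorem inducedAux_erase {n : ℕ} (w : List ℕ) (hw : ∀ a ∈ w, 1 ≤ a ∧ a ≤ n - 1)
    (π : Equiv.Perm ℕ) (hπ : ∀ j, π j ∈ Finset.Icc 1 n ↔ j ∈ Finset.Icc 1 n)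
    (p : ℕ) (hp : 1 ≤ p) :
    inducedAux ((Finset.Icc 1 n).erase (π p)) w π = deleteWire p w := by
  induction w generalizing π p with
  | nil => rfl
  | cons a w ih =>
    have ha := hw a (by simp)
    have hrec : inducedAux ((Finset.Icc 1 n).erase (π p)) w (π * adjTransposition a) =
        deleteWire (adjTransposition a p) w := by
      have key := ih (fun b hb => hw b (by simp [hb])) (π * adjTransposition a)
        (fun j => by
          rw [Equiv.Perm.mul_apply, hπ, adjTransposition_mem_Icc_iff ha])
        (adjTransposition a p) (by
          simp only [adjTransposition, Equiv.swap_apply_def]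
          split_ifs <;> omega)
      rwa [Equiv.Perm.mul_apply, show adjTransposition a (adjTransposition a p) = p by
        simp [adjTransposition]] at key
    have hmem : ∀ q, π q ∈ (Finset.Icc 1 n).erase (π p) ↔ q ≠ p ∧ 1 ≤ q ∧ q ≤ n := by
      intro q
      rw [Finset.mem_erase, hπ, Finset.mem_Icc, π.injective.ne_iff]
    have hfilter : (Finset.Icc 1 a).filter (fun q => π q ∈ (Finset.Icc 1 n).erase (π p)) =
        (Finset.Icc 1 a).erase p := by
      ext q
      simp only [Finset.mem_filter, hmem, Finset.mem_erase, Finset.mem_Icc]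
      omega
    rw [inducedAux, hrec, hfilter, deleteWire]
    simp only [hmem, adjTransposition, Equiv.swap_apply_def]
    simp only [Finset.card_erase_eq_ite, Nat.card_Icc, Finset.mem_Icc]
    split_ifs <;> first | omega | simp

/-- The number of wires among `1, …, 5` whose deletion from `w` leaves a reentrant word. -/
def reentrantCount (w : List ℕ) : ℕ :=
  [1, 2, 3, 4, 5].countP fun i =>
    [[1,2,3,2,1,2], [3,2,1,2,3,2], [2,1,2,3,2,1], [2,3,2,1,2,3]].contains (deleteWire i w)

theorem card_filter_inducedWord_mem_reentrantSet (w : List ℕ)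
    (hw : ∀ a ∈ w, 1 ≤ a ∧ a ≤ 5 - 1) :
    (((Finset.Icc 1 5).powersetCard 4).filter
      (fun A => inducedWord w A ∈ reentrantSet)).card = reentrantCount w := by
  have himage : (Finset.Icc 1 5).powersetCard 4 =
      (Finset.Icc 1 5).image (fun i => (Finset.Icc 1 5).erase i) := by decide
  rw [himage, Finset.filter_image, Finset.card_image_of_injOn
    ((Finset.erase_injOn (Finset.Icc 1 5)).mono fun _ h => (Finset.mem_filter.1 h).1)]
  have hind : ∀ i ∈ Finset.Icc 1 5,
      (inducedWord w ((Finset.Icc 1 5).erase i) ∈ reentrantSet ↔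
        [[1,2,3,2,1,2], [3,2,1,2,3,2], [2,1,2,3,2,1], [2,3,2,1,2,3]].contains
          (deleteWire i w) = true) := by
    intro i hi
    have h := inducedAux_erase w hw 1 (fun _ => Iff.rfl) i (Finset.mem_Icc.1 hi).1
    rw [Equiv.Perm.one_apply] at h
    rw [inducedWord, h, List.contains_iff_mem]
    simp [reentrantSet]
  rw [Finset.filter_congr hind, show Finset.Icc 1 5 = [1, 2, 3, 4, 5].toFinset from rfl,
    ← List.toFinset_filter, List.toFinset_card_of_nodup (List.Nodup.filter _ (by decide)),
    reentrantCount, List.countP_eq_length_filter]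

/-- The one-line notation of a permutation of `{1, …, 5}`. -/
def oneLine (π : Equiv.Perm ℕ) : List ℕ := [1, 2, 3, 4, 5].map π

/-- Exchange the entries with (zero-based) indices `a` and `a + 1`. -/
def swapAdjacent : ℕ → List ℕ → List ℕ
  | 0, x :: y :: t => y :: x :: t
  | a + 1, x :: t => x :: swapAdjacent a t
  | _, l => l

/-- Whether the entries with (zero-based) indices `a` and `a + 1` are increasing. -/
def isAscent : ℕ → List ℕ → Bool
  | 0, x :: y :: _ => Nat.blt x y
  | a + 1, _ :: t => isAscent a t
  | _, _ => false

/-- The number of inversions of a list. -/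
def inversions : List ℕ → ℕ
  | [] => 0
  | x :: t => t.countP (· < x) + inversions t

theorem swapAdjacent_perm (a : ℕ) (l : List ℕ) : (swapAdjacent a l).Perm l := by
  fun_induction swapAdjacent a l with
  | case1 x y t => exact List.Perm.swap x y t
  | case2 a x t ih => exact ih.cons x
  | case3 => exact List.Perm.refl _

theorem inversions_swapAdjacent_of_isAscent (a : ℕ) (l : List ℕ) (h : isAscent a l) :
    inversions (swapAdjacent a l) = inversions l + 1 := by
  fun_induction swapAdjacent a l with
  | case1 x y t =>
    have hxy : x < y := by simpa [isAscent] using h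
    simp only [inversions, List.countP_cons, hxy, not_lt_of_gt hxy, decide_true, decide_false]
    simp
    omega
  | case2 a x t ih =>
    simp only [inversions, (swapAdjacent_perm a t).countP_eq, ih (by simpa [isAscent] using h)]
    omega
  | case3 a l h₁ h₂ =>
    unfold isAscent at h
    split at h <;> simp_all

theorem inversions_swapAdjacent_le_of_not_isAscent (a : ℕ) (l : List ℕ)
    (h : ¬ isAscent a l) : inversions (swapAdjacent a l) ≤ inversions l := by
  fun_induction swapAdjacent a l with
  | case1 x y t =>
    have hxy : ¬ x < y := by simpa [isAscent] using h
    simp only [inversions, List.countP_cons, hxy, decide_false]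
    simp
    omega
  | case2 a x t ih =>
    have := ih (by simpa [isAscent] using h)
    simp only [inversions, (swapAdjacent_perm a t).countP_eq]
    omega
  | case3 => exact le_rfl

theorem inversions_swapAdjacent_le (a : ℕ) (l : List ℕ) :
    inversions (swapAdjacent a l) ≤ inversions l + 1 := by
  by_cases h : isAscent a l
  · exact (inversions_swapAdjacent_of_isAscent a l h).le
  · exact (inversions_swapAdjacent_le_of_not_isAscent a l h).trans (Nat.le_succ _)

theorem oneLine_mul_adjTransposition (π : Equiv.Perm ℕ) {a : ℕ} (ha : a < 4) :
    oneLine (π * adjTransposition (a + 1)) = swapAdjacent a (oneLine π) := by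
  interval_cases a <;> simp [oneLine, swapAdjacent, adjTransposition, Equiv.swap_apply_def]

theorem oneLine_longWord : oneLine (longWord 5) = [5, 4, 3, 2, 1] := by
  simp [oneLine, longWord]

theorem eq_longWord_iff (π : Equiv.Perm ℕ) (hπ : ∀ j, j ∉ Finset.Icc 1 5 → π j = j) :
    π = longWord 5 ↔ oneLine π = [5, 4, 3, 2, 1] := by
  refine ⟨fun h => h ▸ oneLine_longWord, fun h => Equiv.ext fun j => ?_⟩
  by_cases hj : j ∈ Finset.Icc 1 5
  · rw [← oneLine_longWord] at h
    exact List.map_inj_left.1 h j (by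
      rw [Finset.mem_Icc] at hj
      simp only [List.mem_cons, List.not_mem_nil]
      omega)
  · rw [hπ j hj]
    rw [Finset.mem_Icc] at hj
    simp [longWord, hj]

theorem le_inversions_add_length (w : List ℕ) (hw : ∀ a ∈ w, 1 ≤ a ∧ a ≤ 5 - 1)
    (π : Equiv.Perm ℕ) (h : π * (w.map adjTransposition).prod = longWord 5) :
    10 ≤ inversions (oneLine π) + w.length := by
  induction w generalizing π with
  | nil =>
    rw [List.map_nil, List.prod_nil, mul_one] at h
    rw [h, oneLine_longWord]
    decide
  | cons a w ih =>
    obtain ⟨b, rfl⟩ := Nat.exists_eq_add_of_le' (hw a (by simp)).1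
    have hb : b < 4 := by have := (hw _ List.mem_cons_self).2; omega
    rw [List.map_cons, List.prod_cons, ← mul_assoc] at h
    have := ih (fun c hc => hw c (by simp [hc])) _ h
    rw [oneLine_mul_adjTransposition π hb] at this
    have := inversions_swapAdjacent_le b (oneLine π)
    rw [List.length_cons]
    omega

/-- The words of length `k` that lead from the one-line notation `l` to that of the long word
through ascents only. -/
def ascendingWords : ℕ → List ℕ → List (List ℕ)
  | 0, l => if l = [5, 4, 3, 2, 1] then [[]] else []
  | k + 1, l => [0, 1, 2, 3].flatMap fun a =>
      bif isAscent a l then (ascendingWords k (swapAdjacent a l)).map ((a + 1) :: ·) else []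

theorem cons_mem_ascendingWords (k : ℕ) (l : List ℕ) (b : ℕ) (w : List ℕ) :
    b :: w ∈ ascendingWords (k + 1) l ↔ ∃ a < 4, b = a + 1 ∧ isAscent a l ∧
      w ∈ ascendingWords k (swapAdjacent a l) := by
  have hmem : ∀ a, a ∈ [0, 1, 2, 3] ↔ a < 4 := by intro a; simp; omega
  rw [ascendingWords, List.mem_flatMap]
  refine exists_congr fun a => ?_
  rw [hmem]
  cases isAscent a l <;> simp [and_comm, eq_comm]

theorem mem_ascendingWords (k : ℕ) (π : Equiv.Perm ℕ)
    (hπ : ∀ j, j ∉ Finset.Icc 1 5 → π j = j) (hk : inversions (oneLine π) + k = 10)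
    (w : List ℕ) :
    w ∈ ascendingWords k (oneLine π) ↔ w.length = k ∧ (∀ a ∈ w, 1 ≤ a ∧ a ≤ 5 - 1) ∧
      π * (w.map adjTransposition).prod = longWord 5 := by
  induction k generalizing π w with
  | zero =>
    rw [ascendingWords, List.length_eq_zero_iff]
    constructor
    · intro h
      split_ifs at h with hl
      · obtain rfl : w = [] := by simpa using h
        simpa using (eq_longWord_iff π hπ).2 hl
      · simp at h
    · rintro ⟨rfl, -, h⟩
      rw [List.map_nil, List.prod_nil, mul_one, eq_longWord_iff π hπ] at h
      simp [h]
  | succ k ih =>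
    cases w with
    | nil =>
      simp only [ascendingWords, List.mem_flatMap, List.length_nil]
      refine ⟨?_, fun h => by omega⟩
      rintro ⟨a, -, ha⟩
      cases h : isAscent a (oneLine π) <;> simp [h] at ha
    | cons b w =>
      have hstep : ∀ a < 4, isAscent a (oneLine π) →
          (w ∈ ascendingWords k (swapAdjacent a (oneLine π)) ↔
            w.length = k ∧ (∀ a ∈ w, 1 ≤ a ∧ a ≤ 5 - 1) ∧
              π * adjTransposition (a + 1) * (w.map adjTransposition).prod = longWord 5) := by
        intro a ha hasc
        rw [← oneLine_mul_adjTransposition π ha]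
        refine ih _ (fun j hj => ?_) ?_ w
        · rw [Equiv.Perm.mul_apply, hπ _ (by
            rwa [adjTransposition_mem_Icc_iff ⟨by omega, by omega⟩])]
          rw [Finset.mem_Icc] at hj
          exact Equiv.swap_apply_of_ne_of_ne (by omega) (by omega)
        · rw [oneLine_mul_adjTransposition π ha,
            inversions_swapAdjacent_of_isAscent a _ hasc]
          omega
      rw [cons_mem_ascendingWords, List.length_cons, List.forall_mem_cons, List.map_cons,
        List.prod_cons, ← mul_assoc]
      constructor
      · rintro ⟨a, ha, rfl, hasc, hw⟩
        obtain ⟨h₁, h₂, h₃⟩ := (hstep a ha hasc).1 hw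
        exact ⟨by omega, ⟨by omega, h₂⟩, h₃⟩
      · rintro ⟨h₁, ⟨hb, h₂⟩, h₃⟩
        obtain ⟨a, rfl⟩ := Nat.exists_eq_add_of_le' hb.1
        have ha : a < 4 := by omega
        have hasc : isAscent a (oneLine π) := by
          by_contra hdesc
          have h₄ := inversions_swapAdjacent_le_of_not_isAscent a _ hdesc
          have h₅ := le_inversions_add_length w h₂ _ h₃
          rw [oneLine_mul_adjTransposition π ha] at h₅
          omega
        exact ⟨a, ha, rfl, hasc, (hstep a ha hasc).2 ⟨by omega, h₂, h₃⟩⟩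

theorem nodup_ascendingWords (k : ℕ) (l : List ℕ) : (ascendingWords k l).Nodup := by
  induction k generalizing l with
  | zero =>
    rw [ascendingWords]
    split_ifs <;> simp
  | succ k ih =>
    rw [ascendingWords, List.nodup_flatMap]
    constructor
    · intro a _
      cases isAscent a l
      · exact List.nodup_nil
      · exact (ih _).map (List.cons_injective)
    · refine List.Pairwise.imp (R := (· ≠ ·)) ?_ (by decide)
      have hhead : ∀ a, ∀ w ∈ (bif isAscent a l then
          (ascendingWords k (swapAdjacent a l)).map ((a + 1) :: ·) else []),
          w.head? = some (a + 1) := by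
        intro a w hw
        cases ha : isAscent a l
        · simp [ha] at hw
        · simp only [ha, cond_true, List.mem_map] at hw
          obtain ⟨u, -, rfl⟩ := hw
          rfl
      intro a b hab w hwa hwb
      exact hab (by simpa using (hhead a w hwa).symm.trans (hhead b w hwb))

theorem isReducedWord_five_iff (w : List ℕ) :
    IsReducedWord 5 w ↔ w ∈ ascendingWords 10 [1, 2, 3, 4, 5] := by
  rw [show [1, 2, 3, 4, 5] = oneLine 1 from rfl,
    mem_ascendingWords 10 1 (fun _ _ => rfl) (by decide), one_mul]
  rfl

theorem natCard_isReducedWord_five (c : ℕ) :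
    Nat.card {w : List ℕ // IsReducedWord 5 w ∧
      (((Finset.Icc 1 5).powersetCard 4).filter
        (fun A => inducedWord w A ∈ reentrantSet)).card = c} =
      ((ascendingWords 10 [1, 2, 3, 4, 5]).map reentrantCount).count c := by
  rw [List.count, List.countP_map, List.countP_eq_length_filter,
    ← List.toFinset_card_of_nodup ((nodup_ascendingWords _ _).filter _)]
  refine Nat.subtype_card _ fun w => ?_
  rw [List.mem_toFinset, List.mem_filter, ← isReducedWord_five_iff]
  refine and_congr_right fun hw => ?_
  rw [card_filter_inducedWord_mem_reentrantSet w hw.2.1]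
  simp

theorem count_reentrantCount_ascendingWords :
    (∀ c ∈ (ascendingWords 10 [1, 2, 3, 4, 5]).map reentrantCount, c = 0 ∨ c = 2 ∨ c = 4) ∧
    ((ascendingWords 10 [1, 2, 3, 4, 5]).map reentrantCount).count 4 = 40 ∧
    ((ascendingWords 10 [1, 2, 3, 4, 5]).map reentrantCount).count 2 = 400 ∧
    ((ascendingWords 10 [1, 2, 3, 4, 5]).map reentrantCount).count 0 = 328 := by
  decide +kernel

/-- For every reduced word `w` for the long word in `S₅`, the number of 4-element
subsets `A ⊆ {1,…,5}` whose induced word is reentrant is `0`, `2`, or `4`;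
moreover exactly `40` reduced words have this count equal to `4`, exactly `400`
have it equal to `2`, and exactly `328` have it equal to `0`. -/
theorem reentrant_subset_counts_S5 :
    (∀ w : List ℕ, IsReducedWord 5 w →
      (((Finset.Icc 1 5).powersetCard 4).filter
          (fun A => inducedWord w A ∈ reentrantSet)).card ∈ ({0, 2, 4} : Set ℕ)) ∧
    Nat.card {w : List ℕ // IsReducedWord 5 w ∧
      (((Finset.Icc 1 5).powersetCard 4).filter
          (fun A => inducedWord w A ∈ reentrantSet)).card = 4} = 40 ∧
    Nat.card {w : List ℕ // IsReducedWord 5 w ∧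
      (((Finset.Icc 1 5).powersetCard 4).filter
          (fun A => inducedWord w A ∈ reentrantSet)).card = 2} = 400 ∧
    Nat.card {w : List ℕ // IsReducedWord 5 w ∧
      (((Finset.Icc 1 5).powersetCard 4).filter
          (fun A => inducedWord w A ∈ reentrantSet)).card = 0} = 328 := by
  obtain ⟨h, h₄, h₂, h₀⟩ := count_reentrantCount_ascendingWords
  refine ⟨fun w hw => ?_, ?_, ?_, ?_⟩
  · rw [card_filter_inducedWord_mem_reentrantSet w hw.2.1]
    exact h _ (List.mem_map_of_mem ((isReducedWord_five_iff w).1 hw))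
  · rw [natCard_isReducedWord_five, h₄]
  · rw [natCard_isReducedWord_five, h₂]
  · rw [natCard_isReducedWord_five, h₀]
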